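/- arXiv:1609.04127 — 3 statements merged into one kernel-verified Lean document; each statement's English description precedes it below -/
import Mathlib

section
/- Let V be a two-dimensional complex vector space equipped with a ℂ-bilinear commutative multiplication admitting a unit element e (i.e. e·x = x for all x ∈ V). Then the multiplication is associative, and there exists a ℂ-linear multiplicative unital isomorphism from V onto either ℂ[X]/(X²) or ℂ × ℂ. -/
open Polynomial

theorem basis_of_linearIndependent_pair {M : Type*} [AddCommGroup M] [Module ℂ M]
    (hdim : Module.finrank ℂ M = 2) {x y : M} (h : LinearIndependent ℂ ![x, y]) :
    ∃ b : Module.Basis (Fin 2) ℂ M, b 0 = x ∧ b 1 = y := by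
  refine ⟨basisOfLinearIndependentOfCardEqFinrank h (by simp [hdim]), ?_, ?_⟩ <;> simp

/-- A two-dimensional unital commutative multiplication has a basis `e, u` with
`u * u = c • e`, where `c` is `0` or `1`. -/
theorem exists_linearIndependent_pair_mul_self_eq {V : Type*} [AddCommGroup V] [Module ℂ V]
    (hdim : Module.finrank ℂ V = 2) (mul : V →ₗ[ℂ] V →ₗ[ℂ] V)
    (hcomm : ∀ x y : V, mul x y = mul y x) (e : V) (he : ∀ x : V, mul e x = x) :
    ∃ (u : V) (c : ℂ), LinearIndependent ℂ ![e, u] ∧ mul u u = c • e ∧ (c = 0 ∨ c = 1) := by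
  have : Nontrivial V := Module.nontrivial_of_finrank_pos (R := ℂ) (by omega)
  have he0 : e ≠ 0 := by
    rintro rfl
    obtain ⟨x, hx⟩ := exists_ne (0 : V)
    exact hx (by simpa using (he x).symm)
  obtain ⟨v, hv⟩ := exists_linearIndependent_pair_of_one_lt_finrank (R := ℂ) (by omega) he0
  obtain ⟨b, rfl, rfl⟩ := basis_of_linearIndependent_pair hdim hv
  obtain ⟨p, q, hpq⟩ : ∃ p q : ℂ, mul (b 1) (b 1) = p • b 0 + q • b 1 :=
    ⟨_, _, (b.sum_repr (mul (b 1) (b 1))).symm.trans (Fin.sum_univ_two _)⟩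
  have hli (r : ℂ) (hr : r ≠ 0) : LinearIndependent ℂ ![b 0, r • (b 1 - (q / 2) • b 0)] := by
    rw [LinearIndependent.pair_iff] at hv ⊢
    intro s t hst
    obtain ⟨h0, h1⟩ := hv (s - t * r * (q / 2)) (t * r) (by rw [← hst]; module)
    have ht : t = 0 := by simpa [hr] using h1
    exact ⟨by simpa [ht] using h0, ht⟩
  have hsq (r : ℂ) : mul (r • (b 1 - (q / 2) • b 0)) (r • (b 1 - (q / 2) • b 0)) =
      (r ^ 2 * (p + q ^ 2 / 4)) • b 0 := by
    simp only [map_smul, map_sub, LinearMap.smul_apply, LinearMap.sub_apply, he,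
      hcomm (b 1) (b 0), hpq]
    module
  by_cases hd : p + q ^ 2 / 4 = 0
  · exact ⟨_, 0, hli 1 one_ne_zero, by rw [hsq, hd, mul_zero], Or.inl rfl⟩
  · obtain ⟨s, hs⟩ := IsAlgClosed.exists_pow_nat_eq (p + q ^ 2 / 4) (n := 2) (by omega)
    have hs0 : s ≠ 0 := by
      rintro rfl
      exact hd (by rw [← hs]; simp)
    refine ⟨_, 1, hli s⁻¹ (inv_ne_zero hs0), ?_, Or.inr rfl⟩
    rw [hsq, ← hs, inv_pow, inv_mul_cancel₀ (pow_ne_zero 2 hs0)]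

/-- Two-dimensional unital commutative multiplications with matching bases are isomorphic. -/
theorem exists_linearEquiv_map_mul {V A : Type*} [AddCommGroup V] [Module ℂ V]
    [CommRing A] [Algebra ℂ A]
    (hV : Module.finrank ℂ V = 2) (hA : Module.finrank ℂ A = 2) (mul : V →ₗ[ℂ] V →ₗ[ℂ] V)
    (hcomm : ∀ x y : V, mul x y = mul y x) (e : V) (he : ∀ x : V, mul e x = x)
    {u : V} {c : ℂ} (hu : LinearIndependent ℂ ![e, u]) (huu : mul u u = c • e)
    {t : A} (ht : LinearIndependent ℂ ![1, t]) (htt : t * t = c • (1 : A)) :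
    ∃ B : V ≃ₗ[ℂ] A, (∀ x y : V, B (mul x y) = B x * B y) ∧ B e = 1 := by
  obtain ⟨b, rfl, rfl⟩ := basis_of_linearIndependent_pair hV hu
  obtain ⟨b', h0, rfl⟩ := basis_of_linearIndependent_pair hA ht
  set B := b.equiv b' (Equiv.refl _)
  have hB0 : B (b 0) = 1 := by simp [B, h0]
  have hB1 : B (b 1) = b' 1 := by simp [B]
  refine ⟨B, fun x y => ?_, hB0⟩
  have key : mul.compr₂ (B : V →ₗ[ℂ] A) =
      (LinearMap.mul ℂ A).compl₁₂ (B : V →ₗ[ℂ] A) (B : V →ₗ[ℂ] A) := by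
    refine LinearMap.ext_basis b b fun i j => ?_
    fin_cases i <;> fin_cases j <;> simp [he, hcomm (b 1) (b 0), huu, hB0, hB1, htt]
  simpa using LinearMap.congr_fun₂ key x y

theorem assoc_of_linearEquiv_map_mul {V A : Type*} [AddCommGroup V] [Module ℂ V]
    [CommRing A] [Algebra ℂ A] (mul : V →ₗ[ℂ] V →ₗ[ℂ] V) (B : V ≃ₗ[ℂ] A)
    (hB : ∀ x y : V, B (mul x y) = B x * B y) (x y z : V) :
    mul (mul x y) z = mul x (mul y z) :=
  B.injective (by simp only [hB, mul_assoc])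

theorem linearIndependent_one_mk_X :
    LinearIndependent ℂ ![(1 : ℂ[X] ⧸ Ideal.span {(X : ℂ[X]) ^ 2}), Ideal.Quotient.mk _ X] := by
  rw [LinearIndependent.pair_iff]
  intro s t hst
  have hmem : s • (1 : ℂ[X]) + t • X ∈ Ideal.span {(X : ℂ[X]) ^ 2} :=
    Ideal.Quotient.eq_zero_iff_mem.mp hst
  rw [Ideal.mem_span_singleton, X_pow_dvd_iff] at hmem
  exact ⟨by simpa using hmem 0 (by omega), by simpa [coeff_one] using hmem 1 (by omega)⟩

/-- Any two-dimensional commutative (not assumed associative)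
unital `ℂ`-algebra is associative, and is isomorphic (via a `ℂ`-linear,
multiplicative, unital isomorphism) to either `ℂ[X]/(X²)` or `ℂ × ℂ`. -/
theorem two_dim_unital_commutative_algebra_classification
    {V : Type*} [AddCommGroup V] [Module ℂ V]
    (hdim : Module.finrank ℂ V = 2)
    (mul : V →ₗ[ℂ] V →ₗ[ℂ] V)
    (hcomm : ∀ x y : V, mul x y = mul y x)
    (e : V) (he : ∀ x : V, mul e x = x) :
    (∀ x y z : V, mul (mul x y) z = mul x (mul y z)) ∧
      ((∃ B : V ≃ₗ[ℂ] (Polynomial ℂ ⧸ Ideal.span {(X : Polynomial ℂ) ^ 2}),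
          (∀ x y : V, B (mul x y) = B x * B y) ∧ B e = 1) ∨
        (∃ B : V ≃ₗ[ℂ] ℂ × ℂ,
          (∀ x y : V, B (mul x y) = B x * B y) ∧ B e = 1)) := by
  obtain ⟨u, c, hu, huu, rfl | rfl⟩ :=
    exists_linearIndependent_pair_mul_self_eq hdim mul hcomm e he
  · have hA : Module.finrank ℂ (ℂ[X] ⧸ Ideal.span {(X : ℂ[X]) ^ 2}) = 2 := by
      rw [finrank_quotient_span_eq_natDegree, natDegree_X_pow]
    have hX : Ideal.Quotient.mk (Ideal.span {(X : ℂ[X]) ^ 2}) X * Ideal.Quotient.mk _ X =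
        (0 : ℂ) • 1 := by
      rw [zero_smul, ← map_mul, ← sq, Ideal.Quotient.eq_zero_iff_mem]
      exact Ideal.mem_span_singleton_self _
    obtain ⟨B, hB, hB1⟩ := exists_linearEquiv_map_mul hdim hA mul hcomm e he hu huu
      linearIndependent_one_mk_X hX
    exact ⟨assoc_of_linearEquiv_map_mul mul B hB, Or.inl ⟨B, hB, hB1⟩⟩
  · have ht : LinearIndependent ℂ ![(1 : ℂ × ℂ), (1, -1)] := by
      rw [LinearIndependent.pair_iff]
      intro s t hst
      have h1 : s + t = 0 := by simpa using congrArg Prod.fst hst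
      have h2 : s - t = 0 := by simpa [sub_eq_add_neg] using congrArg Prod.snd hst
      exact ⟨by linear_combination (h1 + h2) / 2, by linear_combination (h1 - h2) / 2⟩
    obtain ⟨B, hB, hB1⟩ := exists_linearEquiv_map_mul hdim (by simp) mul hcomm e he hu huu ht
      (by ext <;> simp)
    exact ⟨assoc_of_linearEquiv_map_mul mul B hB, Or.inr ⟨B, hB, hB1⟩⟩
end

section
/- Let V be a finite-dimensional unital associative ℂ-algebra, endowed with the topology induced by any norm. For every natural number k, the set { x ∈ V : δ(x) ≤ k } is closed in V; equivalently, the function x ↦ δ(x) is lower semicontinuous on V. -/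
/-- Near `x`, the subalgebra generated by `y` has dimension at least that of the subalgebra
generated by `x`: if the `pᵢ(x)` form a basis of `𝕜[x]`, then the `pᵢ(y)` remain linearly
independent for `y` close to `x`. -/
theorem eventually_finrank_adjoin_singleton_le {𝕜 V : Type*} [NontriviallyNormedField 𝕜]
    [CompleteSpace 𝕜] [NormedRing V] [NormedAlgebra 𝕜 V] [FiniteDimensional 𝕜 V] (x : V) :
    ∀ᶠ y in nhds x, Module.finrank 𝕜 (Algebra.adjoin 𝕜 ({x} : Set V)) ≤
      Module.finrank 𝕜 (Algebra.adjoin 𝕜 ({y} : Set V)) := by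
  let b := Module.finBasis 𝕜 (Algebra.adjoin 𝕜 ({x} : Set V))
  have hp (i) : ∃ p : Polynomial 𝕜, Polynomial.aeval x p = (b i : V) :=
    (Algebra.adjoin_singleton_eq_range_aeval 𝕜 x).le (b i).2
  choose p hp using hp
  have hcont : Continuous fun (y : V) i => Polynomial.aeval y (p i) :=
    continuous_pi fun i => (p i).continuous_aeval
  have hx : LinearIndependent 𝕜 fun i => Polynomial.aeval x (p i) := by
    simp only [hp]
    exact b.linearIndependent.map' (Algebra.adjoin 𝕜 ({x} : Set V)).toSubmodule.subtype
      (Submodule.ker_subtype _)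
  filter_upwards [hcont.continuousAt.preimage_mem_nhds
    (isOpen_setOfPred_linearIndependent.mem_nhds hx)] with y hy
  have hli : LinearIndependent 𝕜 fun i =>
      (⟨Polynomial.aeval y (p i), Polynomial.aeval_mem_adjoin_singleton 𝕜 y⟩ :
        Algebra.adjoin 𝕜 ({y} : Set V)) :=
    LinearIndependent.of_comp (Algebra.adjoin 𝕜 ({y} : Set V)).toSubmodule.subtype hy
  simpa using hli.fintype_card_le_finrank


/-- Let `V` be a finite-dimensional unital associative normed
`ℂ`-algebra (in finite dimension the topology does not depend on the choice of
the norm).  For `x ∈ V` set `δ(x) = dim_ℂ ℂ[x]`, where `ℂ[x]` is the unital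
subalgebra generated by `x`.  Then for every `k` the set `{x | δ(x) ≤ k}` is
closed; equivalently, `δ` is lower semicontinuous. -/
theorem isClosed_delta_le_and_lowerSemicontinuous_delta
    {V : Type*} [NormedRing V] [NormedAlgebra ℂ V] [FiniteDimensional ℂ V] :
    (∀ k : ℕ,
      IsClosed {x : V | Module.finrank ℂ (Algebra.adjoin ℂ ({x} : Set V)) ≤ k}) ∧
    LowerSemicontinuous
      (fun x : V => Module.finrank ℂ (Algebra.adjoin ℂ ({x} : Set V))) := by
  have h : LowerSemicontinuous
      (fun x : V => Module.finrank ℂ (Algebra.adjoin ℂ ({x} : Set V))) := fun x _ hk =>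
    (eventually_finrank_adjoin_singleton_le x).mono fun _ hy => hk.trans_le hy
  exact ⟨fun k => h.isClosed_preimage k, h⟩
end

section
/- Let V be a finite-dimensional unital associative ℂ-algebra and let δ_V = max_{x ∈ V} δ(x). If x, y ∈ V satisfy δ(x) = δ(y) = δ_V and y ∉ ℂ[x], then every element z ∈ ℂ[x] ∩ ℂ[y] satisfies δ(z) < δ_V. -/
/-- Let `V` be a finite-dimensional unital associative
`ℂ`-algebra and `δ_V = max_{x ∈ V} δ(x)` where `δ(x) = dim_ℂ ℂ[x]`.  If
`δ(x) = δ(y) = δ_V` and `y ∉ ℂ[x]`, then every `z ∈ ℂ[x] ∩ ℂ[y]` satisfies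
`δ(z) < δ_V`. -/
theorem delta_lt_of_mem_inter_adjoin
    {V : Type*} [Ring V] [Algebra ℂ V] [FiniteDimensional ℂ V]
    (δV : ℕ)
    (hmax : ∀ z : V, Module.finrank ℂ (Algebra.adjoin ℂ ({z} : Set V)) ≤ δV)
    (hattained : ∃ z : V, Module.finrank ℂ (Algebra.adjoin ℂ ({z} : Set V)) = δV)
    (x y : V)
    (hx : Module.finrank ℂ (Algebra.adjoin ℂ ({x} : Set V)) = δV)
    (hy : Module.finrank ℂ (Algebra.adjoin ℂ ({y} : Set V)) = δV)
    (hxy : y ∉ Algebra.adjoin ℂ ({x} : Set V)) :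
    ∀ z : V, z ∈ Algebra.adjoin ℂ ({x} : Set V) → z ∈ Algebra.adjoin ℂ ({y} : Set V) →
      Module.finrank ℂ (Algebra.adjoin ℂ ({z} : Set V)) < δV := by
  intro z hzx hzy
  refine lt_of_le_of_ne (hmax z) fun hz => hxy ?_
  have adjoin_eq : ∀ w : V, z ∈ Algebra.adjoin ℂ ({w} : Set V) →
      Module.finrank ℂ (Algebra.adjoin ℂ ({w} : Set V)) = δV →
      Algebra.adjoin ℂ ({z} : Set V) = Algebra.adjoin ℂ ({w} : Set V) := fun w hzw hw =>
    Subalgebra.toSubmodule_injective <| Submodule.eq_of_le_of_finrank_eq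
      (Algebra.adjoin_le (Set.singleton_subset_iff.mpr hzw)) (hz.trans hw.symm)
  rw [← adjoin_eq x hzx hx, adjoin_eq y hzy hy]
  exact Algebra.self_mem_adjoin_singleton ℂ y
end
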